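/- Let S be a Gδ subset of ℝ, let g : S → ℝ be continuous, let θ ∈ ℝ, and let G = ρ_θ({(x, g x) | x ∈ S}). Then the collection of lines ℓ of ℝ² such that G ∩ ℓ is somewhere dense in ℓ is at most countable. -/

import Mathlib

open Cardinal Set

noncomputable section

/-- The line through `p` with direction `v`. -/
def lineThrough (p v : ℝ × ℝ) : Set (ℝ × ℝ) := {q | ∃ t : ℝ, q = p + t • v}

/-- `L` is a straight line of `ℝ²`. -/
def IsLine (L : Set (ℝ × ℝ)) : Prop := ∃ p v : ℝ × ℝ, v ≠ 0 ∧ L = lineThrough p v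

/-- `L` is a vertical line of `ℝ²`. -/
def IsVerticalLine (L : Set (ℝ × ℝ)) : Prop := ∃ x : ℝ, L = {p : ℝ × ℝ | p.1 = x}

/-- `L₁` and `L₂` are parallel lines. -/
def ParallelLines (L₁ L₂ : Set (ℝ × ℝ)) : Prop :=
  ∃ (p₁ p₂ v : ℝ × ℝ) (c : ℝ), v ≠ 0 ∧ c ≠ 0 ∧
    L₁ = lineThrough p₁ v ∧ L₂ = lineThrough p₂ (c • v)

/-- A Mazurkiewicz set meets every line in exactly two points. -/
def IsMazurkiewicz (M : Set (ℝ × ℝ)) : Prop :=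
  ∀ L : Set (ℝ × ℝ), IsLine L → (M ∩ L).encard = 2

/-- The graph of a partial function `g` defined on `S ⊆ ℝ`. -/
def graphOn (S : Set ℝ) (g : S → ℝ) : Set (ℝ × ℝ) := {p | ∃ x : S, p = ((x : ℝ), g x)}

/-- The graph of a function `f : ℝ → ℝ`. -/
def graphOf (f : ℝ → ℝ) : Set (ℝ × ℝ) := {p | ∃ x : ℝ, p = (x, f x)}

/-- A Sierpiński–Zygmund set. -/
def IsSZSet (X : Set (ℝ × ℝ)) : Prop :=
  ∀ (S : Set ℝ) (g : S → ℝ), Continuous g →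
    #↥(X ∩ graphOn S g) < Cardinal.continuum

/-- A Sierpiński–Zygmund function. -/
def IsSZFun (f : ℝ → ℝ) : Prop :=
  ∀ (S : Set ℝ) (g : S → ℝ), Continuous g →
    #↥{x : S | f x.1 = g x} < Cardinal.continuum

/-- Rotation about the origin by angle `θ`. -/
def rot (θ : ℝ) (p : ℝ × ℝ) : ℝ × ℝ :=
  (p.1 * Real.cos θ - p.2 * Real.sin θ, p.1 * Real.sin θ + p.2 * Real.cos θ)

/-- A Hamel basis of `ℝ²`: a basis of `ℝ × ℝ` as a vector space over `ℚ`. -/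
def IsHamelBasis (H : Set (ℝ × ℝ)) : Prop :=
  LinearIndependent ℚ ((↑) : H → ℝ × ℝ) ∧ Submodule.span ℚ H = ⊤

/-- A Hamel function: a function whose graph is a Hamel basis of `ℝ²`. -/
def IsHamelFun (h : ℝ → ℝ) : Prop := IsHamelBasis (graphOf h)

/-- `A` is somewhere dense in the line `L`: some nonempty relatively open piece of
`L` lies in the closure of `A`. -/
def SomewhereDenseIn (A L : Set (ℝ × ℝ)) : Prop :=
  ∃ U : Set (ℝ × ℝ), IsOpen U ∧ (U ∩ L).Nonempty ∧ U ∩ L ⊆ closure A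

/-- The point of the rotated line `y = a * x + b` lying over `x`. -/
def rotLine (θ a b x : ℝ) : ℝ × ℝ := rot θ (x, a * x + b)

theorem rot_neg_rot (θ : ℝ) (p : ℝ × ℝ) : rot (-θ) (rot θ p) = p := by
  have h := Real.sin_sq_add_cos_sq θ
  ext
  · simp only [rot, Real.cos_neg, Real.sin_neg]
    linear_combination p.1 * h
  · simp only [rot, Real.cos_neg, Real.sin_neg]
    linear_combination p.2 * h

theorem rot_rot_neg (θ : ℝ) (p : ℝ × ℝ) : rot θ (rot (-θ) p) = p := by
  simpa using rot_neg_rot (-θ) p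

theorem rot_injective (θ : ℝ) : Function.Injective (rot θ) :=
  Function.LeftInverse.injective (rot_neg_rot θ)

theorem continuous_rot (θ : ℝ) : Continuous (rot θ) := by
  unfold rot
  fun_prop

theorem continuous_rotLine (θ a b : ℝ) : Continuous (rotLine θ a b) :=
  (continuous_rot θ).comp (by fun_prop)

theorem rot_add_smul (θ t : ℝ) (p v : ℝ × ℝ) :
    rot θ (p + t • v) = rot θ p + t • rot θ v := by
  ext <;> simp only [rot, Prod.fst_add, Prod.snd_add, Prod.smul_fst, Prod.smul_snd,
    smul_eq_mul] <;> ring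

/-- A line that is not vertical after rotating back by `θ` is a rotated line `y = a * x + b`. -/
theorem lineThrough_eq_range_rotLine {θ : ℝ} {p v : ℝ × ℝ} (hv : (rot (-θ) v).1 ≠ 0) :
    ∃ a b : ℝ, lineThrough p v = range (rotLine θ a b) := by
  set w := rot (-θ) v with hw
  set q := rot (-θ) p with hq
  have hpt (t : ℝ) : p + t • v = rot θ (q + t • w) := by
    rw [rot_add_smul, hw, hq, rot_rot_neg, rot_rot_neg]
  refine ⟨w.2 / w.1, q.2 - w.2 / w.1 * q.1, Subset.antisymm ?_ ?_⟩
  · rintro _ ⟨t, rfl⟩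
    refine ⟨q.1 + t * w.1, ?_⟩
    rw [hpt, rotLine]
    congr 1
    ext
    · simp
    · simp only [Prod.snd_add, Prod.smul_snd, smul_eq_mul]
      field_simp
      ring
  · rintro _ ⟨x, rfl⟩
    refine ⟨(x - q.1) / w.1, ?_⟩
    rw [hpt, rotLine]
    congr 1
    ext
    · simp only [Prod.fst_add, Prod.smul_fst, smul_eq_mul]
      field_simp
      ring
    · simp only [Prod.snd_add, Prod.smul_snd, smul_eq_mul]
      field_simp
      ring

theorem SomewhereDenseIn.not_subsingleton {A : Set (ℝ × ℝ)} {p v : ℝ × ℝ} (hv : v ≠ 0)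
    (h : SomewhereDenseIn A (lineThrough p v)) : ¬ A.Subsingleton := by
  rintro hA
  obtain ⟨U, hU, ⟨_, ht₀, t₀, rfl⟩, hsub⟩ := h
  have hopen : IsOpen ((fun t : ℝ => p + t • v) ⁻¹' U) := hU.preimage (by fun_prop)
  obtain ⟨t, ht, hne⟩ : ∃ t ∈ (fun t : ℝ => p + t • v) ⁻¹' U, t ≠ t₀ :=
    (infinite_of_mem_nhds t₀ (hopen.mem_nhds ht₀)).nontrivial.exists_ne t₀
  have heq := hA.closure (hsub ⟨ht, t, rfl⟩) (hsub ⟨ht₀, t₀, rfl⟩)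
  exact hne (smul_left_injective ℝ hv (add_left_cancel heq))

/-- A set meeting a rotated line densely in some segment does so over a rational interval. -/
theorem SomewhereDenseIn.exists_rat_Ioo_subset {θ a b : ℝ} {A : Set (ℝ × ℝ)}
    (h : SomewhereDenseIn (A ∩ range (rotLine θ a b)) (range (rotLine θ a b))) :
    ∃ r s : ℚ, r < s ∧ Ioo (r : ℝ) s ⊆ closure (rotLine θ a b ⁻¹' A) := by
  obtain ⟨U, hU, ⟨_, hx₀, x₀, rfl⟩, hsub⟩ := h
  have hopen := hU.preimage (continuous_rotLine θ a b)
  obtain ⟨l, u, ⟨hl, hu⟩, hlu⟩ := mem_nhds_iff_exists_Ioo_subset.1 (hopen.mem_nhds hx₀)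
  obtain ⟨r, hlr, hr⟩ := exists_rat_btwn hl
  obtain ⟨s, hs, hsu⟩ := exists_rat_btwn hu
  refine ⟨r, s, by exact_mod_cast hr.trans hs, fun x hx => ?_⟩
  have hmem : rotLine θ a b x ∈ closure (A ∩ range (rotLine θ a b)) :=
    hsub ⟨hlu ⟨hlr.trans hx.1, hx.2.trans hsu⟩, x, rfl⟩
  have himg := image_closure_subset_closure_image
    (continuous_fst.comp (continuous_rot (-θ))) (mem_image_of_mem _ hmem)
  have hfst (y : ℝ) : (Prod.fst ∘ rot (-θ)) (rotLine θ a b y) = y := by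
    simp [rotLine, rot_neg_rot]
  rw [hfst] at himg
  refine closure_mono ?_ himg
  rintro _ ⟨_, ⟨hA, y, rfl⟩, rfl⟩
  rwa [hfst]

theorem preimage_rotLine_image_graphOn (S : Set ℝ) (g : S → ℝ) (θ a b : ℝ) :
    rotLine θ a b ⁻¹' (rot θ '' graphOn S g) = (↑) '' {x : S | g x = a * x + b} := by
  ext x
  constructor
  · rintro ⟨_, ⟨y, rfl⟩, hy⟩
    have h := rot_injective θ hy
    simp only [Prod.mk.injEq] at h
    obtain ⟨rfl, h⟩ := h
    exact ⟨y, h, rfl⟩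
  · rintro ⟨y, hy, rfl⟩
    refine ⟨_, ⟨y, rfl⟩, ?_⟩
    rw [rotLine, ← show g y = a * y + b from hy]

/-- A continuous function that is affine on a dense part of an interval is affine on all of its
domain in that interval. -/
theorem eq_affine_of_mem_closure {S : Set ℝ} {g : S → ℝ} (hg : Continuous g) {a b : ℝ} {x : S}
    (hx : (x : ℝ) ∈ closure ((↑) '' {x : S | g x = a * x + b})) : g x = a * x + b := by
  have hclosed : IsClosed {x : S | g x = a * x + b} := isClosed_eq hg (by fun_prop)
  rwa [← closure_subtype, hclosed.closure_eq] at hx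

/-- For the rotation `G` of the graph of a continuous function on a Gδ subset of `ℝ`,
only countably many lines `L` have `G ∩ L` somewhere dense in `L`. -/
theorem stmt_12 (S : Set ℝ) (hS : IsGδ S) (g : S → ℝ) (hg : Continuous g)
    (θ : ℝ) (G : Set (ℝ × ℝ)) (hG : G = rot θ '' graphOn S g) :
    {L : Set (ℝ × ℝ) | IsLine L ∧ SomewhereDenseIn (G ∩ L) L}.Countable := by
  subst hG
  refine Set.Countable.mono (s₂ := ⋃ (r : ℚ) (s : ℚ), {L | r < s ∧ ∃ a b : ℝ,
    L = range (rotLine θ a b) ∧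
      Ioo (r : ℝ) s ⊆ closure ((↑) '' {x : S | g x = a * x + b})}) ?_ ?_
  · rintro L ⟨⟨p, v, hv, rfl⟩, hd⟩
    by_cases hv1 : (rot (-θ) v).1 = 0
    · refine absurd ?_ (hd.not_subsingleton hv)
      have hfst {x : S} {t : ℝ} (h : rot θ (x, g x) = p + t • v) :
          (x : ℝ) = (rot (-θ) p).1 := by
        have h' := congrArg (fun q => (rot (-θ) q).1) h
        simpa [rot_neg_rot, rot_add_smul, hv1] using h'
      rintro _ ⟨⟨_, ⟨x, rfl⟩, rfl⟩, t, ht⟩ _ ⟨⟨_, ⟨y, rfl⟩, rfl⟩, u, hu⟩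
      rw [Subtype.ext ((hfst ht).trans (hfst hu).symm)]
    · obtain ⟨a, b, hab⟩ := lineThrough_eq_range_rotLine (p := p) hv1
      rw [hab] at hd ⊢
      obtain ⟨r, s, hrs, hsub⟩ := hd.exists_rat_Ioo_subset
      rw [preimage_rotLine_image_graphOn] at hsub
      exact mem_iUnion₂.2 ⟨r, s, hrs, a, b, rfl, hsub⟩
  · refine countable_iUnion fun r => countable_iUnion fun s => Set.Subsingleton.countable ?_
    rintro _ ⟨hrs, a, b, rfl, hab⟩ _ ⟨-, a', b', rfl, hab'⟩
    have hrs' : (r : ℝ) < s := by exact_mod_cast hrs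
    have hpoint {l u : ℝ} (hlu : l < u) (hsub : Ioo l u ⊆ Ioo (r : ℝ) s) :
        ∃ x ∈ Ioo l u, a * x + b = a' * x + b' := by
      obtain ⟨m, hm⟩ := nonempty_Ioo.2 hlu
      obtain ⟨_, hx, x, hgx, rfl⟩ := mem_closure_iff.1 (hab (hsub hm)) _ isOpen_Ioo hm
      exact ⟨x, hx, hgx.symm.trans (eq_affine_of_mem_closure hg (hab' (hsub hx)))⟩
    obtain ⟨x, hx, hxeq⟩ := hpoint hrs' Subset.rfl
    obtain ⟨y, hy, hyeq⟩ := hpoint hx.2 (Ioo_subset_Ioo_left hx.1.le)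
    have ha : a = a' :=
      mul_right_cancel₀ (sub_ne_zero.2 hy.1.ne') (by linear_combination hyeq - hxeq)
    subst ha
    rw [add_left_cancel hxeq]
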